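/- Let K be a field, n a positive integer, and m ∈ {1,…,n}. The map F̃_{n,m} : (Mat_n(K))³ → (Mat_n(K))³ given by F̃_{n,m}(X,Y,Z) = (X, Y + Σ_{i=1}^{m} C_i(Z)·R_{n−m+i}(X), Z), where C_i(Z)·R_j(X) is the n×n matrix with (k,l)-th entry z_{k,i} x_{j,l}, satisfies the tetrahedron equation F̃¹²³∘F̃¹⁴⁵∘F̃²⁴⁶∘F̃³⁵⁶ = F̃³⁵⁶∘F̃²⁴⁶∘F̃¹⁴⁵∘F̃¹²³. -/

import Mathlib

/-- `T^{123}` : the map acting as `T` on factors 1,2,3 of `X⁶` and as identity elsewhere. -/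
def t123 {X : Type*} (T : X × X × X → X × X × X) : X × X × X × X × X × X → X × X × X × X × X × X
  | (a, b, c, d, e, f) => match T (a, b, c) with
    | (a', b', c') => (a', b', c', d, e, f)

/-- `T^{145}` : the map acting as `T` on factors 1,4,5 of `X⁶` and as identity elsewhere. -/
def t145 {X : Type*} (T : X × X × X → X × X × X) : X × X × X × X × X × X → X × X × X × X × X × X
  | (a, b, c, d, e, f) => match T (a, d, e) with
    | (a', d', e') => (a', b, c, d', e', f)

/-- `T^{246}` : the map acting as `T` on factors 2,4,6 of `X⁶` and as identity elsewhere. -/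
def t246 {X : Type*} (T : X × X × X → X × X × X) : X × X × X × X × X × X → X × X × X × X × X × X
  | (a, b, c, d, e, f) => match T (b, d, f) with
    | (b', d', f') => (a, b', c, d', e, f')

/-- `T^{356}` : the map acting as `T` on factors 3,5,6 of `X⁶` and as identity elsewhere. -/
def t356 {X : Type*} (T : X × X × X → X × X × X) : X × X × X × X × X × X → X × X × X × X × X × X
  | (a, b, c, d, e, f) => match T (c, e, f) with
    | (c', e', f') => (a, b, c', d, e', f')

/-- The Zamolodchikov tetrahedron equation for a map `T : X³ → X³`. -/
def IsTetrahedronMap {X : Type*} (T : X × X × X → X × X × X) : Prop :=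
  t123 T ∘ t145 T ∘ t246 T ∘ t356 T = t356 T ∘ t246 T ∘ t145 T ∘ t123 T

/-- A biadditive associative operation `g` yields the tetrahedron map
`(x, y, z) ↦ (x, y + g z x, z)`. -/
theorem isTetrahedronMap_add_of_assoc {A : Type*} [AddCommMonoid A] (g : A → A → A)
    (add_left : ∀ x y z, g (x + y) z = g x z + g y z)
    (add_right : ∀ x y z, g x (y + z) = g x y + g x z)
    (assoc : ∀ x y z, g (g x y) z = g x (g y z)) :
    IsTetrahedronMap (fun P : A × A × A => (P.1, P.2.1 + g P.2.2 P.1, P.2.2)) := by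
  funext ⟨a, b, c, d, e, f⟩
  simp only [Function.comp_apply, t123, t145, t246, t356, add_left, add_right, assoc,
    Prod.mk.injEq, true_and, and_true]
  abel

/-- Multiplying the columns of `Z` selected by `p` with the rows of `X` selected by `q` is an
associative operation on square matrices. -/
theorem Matrix.submatrix_mul_submatrix_assoc {ι κ R : Type*} [Fintype κ] [Semiring R]
    (p q : κ → ι) (X Y Z : Matrix ι ι R) :
    (X.submatrix id p * Y.submatrix q id).submatrix id p * Z.submatrix q id =
      X.submatrix id p * (Y.submatrix id p * Z.submatrix q id).submatrix q id :=
  Matrix.mul_assoc (X.submatrix id p) (Y.submatrix q p) (Z.submatrix q id)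

/-- Let `K` be a field, `n ≥ 1`, and `m ∈ {1,…,n}`.  The map
`F̃_{n,m}(X,Y,Z) = (X, Y + Σ_{i=1}^{m} C_i(Z)·R_{n−m+i}(X), Z)`, where `C_i(Z)·R_j(X)` is
the `n×n` matrix with `(k,l)`-th entry `z_{k,i} x_{j,l}`, satisfies the tetrahedron
equation. -/
theorem stmt13 {K : Type*} [Field K] (n m : ℕ) (hm1 : 1 ≤ m) (hmn : m ≤ n) :
    IsTetrahedronMap (fun P : Matrix (Fin n) (Fin n) K × Matrix (Fin n) (Fin n) K ×
        Matrix (Fin n) (Fin n) K =>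
      (P.1,
        P.2.1 + ∑ i : Fin m, Matrix.of (fun k l : Fin n =>
          P.2.2 k (Fin.castLE hmn i) * P.1 ⟨n - m + i.val, by have := i.isLt; omega⟩ l),
        P.2.2)) := by
  let p : Fin m → Fin n := Fin.castLE hmn
  let q : Fin m → Fin n := fun i => ⟨n - m + i.val, by have := i.isLt; omega⟩
  convert isTetrahedronMap_add_of_assoc
    (fun Z X : Matrix (Fin n) (Fin n) K => Z.submatrix id p * X.submatrix q id)
    (fun X Y Z => Matrix.add_mul (X.submatrix id p) (Y.submatrix id p) (Z.submatrix q id))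
    (fun X Y Z => Matrix.mul_add (X.submatrix id p) (Y.submatrix q id) (Z.submatrix q id))
    (Matrix.submatrix_mul_submatrix_assoc p q) using 5
  ext k l
  simp only [Matrix.sum_apply, Matrix.of_apply, Matrix.mul_apply, Matrix.submatrix_apply, id, p, q]
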